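/- arXiv:1411.6143 — 4 statements merged into one kernel-verified Lean document; each statement's English description precedes it below -/
import Mathlib

section
/- Let s1, s2, s3, s4, c1, c2, c3, ρ1, ρ2, h3 be complex numbers such that (X − s1)(X − s2)(X − s3)(X − s4) = ((X − ρ1)(X − ρ2))² − 4h3²·(X − c1)(X − c2)(X − c3) as polynomials in ℂ[X], and such that (s1 − c3)(s2 − c3) = (c3 − ρ1)(c3 − ρ2) and (s3 − c3)(s4 − c3) = (c3 − ρ1)(c3 − ρ2). For α ∈ {1,2,3} define S(i,j,k,l;α) = (s_i − s_j)(s_k − s_l)·[(s_i − c_α)(s_j − c_α) + (s_k − c_α)(s_l − c_α) − 2(c_α − ρ1)(c_α − ρ2)]. Then S(1,2,3,4;3) = 0, and for j ∈ {1,2}: S(1,2,3,4;j) = (s1 − s2)(s3 − s4)·4h3²(c3 − c_j); S(1,4,2,3;j) = (s1 − s4)(s2 − s3)·[(s1 − s3)(s4 − s2) + 4h3²(c3 − c_j)]; S(2,4,1,3;j) = (s2 − s4)(s1 − s3)·[(s3 − s2)(s1 − s4) + 4h3²(c3 − c_j)]. -/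
open Polynomial

/-- Formulas (S_sp): under the pairing condition (sp_cond)
`(s₁ − c₃)(s₂ − c₃) = (s₃ − c₃)(s₄ − c₃) = (c₃ − ρ₁)(c₃ − ρ₂)`, where the `sᵢ` are the roots
of `ψ(X) = ((X − ρ₁)(X − ρ₂))² − 4h₃²(X − c₁)(X − c₂)(X − c₃)`, the quantities
`S(i,j,k,l;α) = (sᵢ − sⱼ)(sₖ − sₗ)·[(sᵢ − c_α)(sⱼ − c_α) + (sₖ − c_α)(sₗ − c_α) − 2(c_α − ρ₁)(c_α − ρ₂)]`
satisfy `S(1,2,3,4;3) = 0` and, for `c ∈ {c₁, c₂}`, the three stated factorizations. -/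
theorem stmt_8 (s₁ s₂ s₃ s₄ c₁ c₂ c₃ ρ₁ ρ₂ h₃ : ℂ)
    (hpoly : (X - C s₁) * (X - C s₂) * (X - C s₃) * (X - C s₄) =
      ((X - C ρ₁) * (X - C ρ₂)) ^ 2
        - C (4 * h₃ ^ 2) * ((X - C c₁) * (X - C c₂) * (X - C c₃)))
    (hpair₁ : (s₁ - c₃) * (s₂ - c₃) = (c₃ - ρ₁) * (c₃ - ρ₂))
    (hpair₂ : (s₃ - c₃) * (s₄ - c₃) = (c₃ - ρ₁) * (c₃ - ρ₂)) :
    (s₁ - s₂) * (s₃ - s₄) * ((s₁ - c₃) * (s₂ - c₃) + (s₃ - c₃) * (s₄ - c₃)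
        - 2 * (c₃ - ρ₁) * (c₃ - ρ₂)) = 0 ∧
    ∀ c ∈ ({c₁, c₂} : Set ℂ),
      (s₁ - s₂) * (s₃ - s₄) * ((s₁ - c) * (s₂ - c) + (s₃ - c) * (s₄ - c)
          - 2 * (c - ρ₁) * (c - ρ₂))
        = (s₁ - s₂) * (s₃ - s₄) * (4 * h₃ ^ 2 * (c₃ - c)) ∧
      (s₁ - s₄) * (s₂ - s₃) * ((s₁ - c) * (s₄ - c) + (s₂ - c) * (s₃ - c)
          - 2 * (c - ρ₁) * (c - ρ₂))
        = (s₁ - s₄) * (s₂ - s₃) * ((s₁ - s₃) * (s₄ - s₂) + 4 * h₃ ^ 2 * (c₃ - c)) ∧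
      (s₂ - s₄) * (s₁ - s₃) * ((s₂ - c) * (s₄ - c) + (s₁ - c) * (s₃ - c)
          - 2 * (c - ρ₁) * (c - ρ₂))
        = (s₂ - s₄) * (s₁ - s₃) * ((s₃ - s₂) * (s₁ - s₄) + 4 * h₃ ^ 2 * (c₃ - c)) := by
  have hsum : s₁ + s₂ + s₃ + s₄ = 2 * (ρ₁ + ρ₂) + 4 * h₃ ^ 2 := by
    have hev (x : ℂ) := congrArg (Polynomial.eval x) hpoly
    simp only [eval_mul, eval_sub, eval_pow, eval_X, eval_C] at hev
    linear_combination (-1 / 6) * (hev 3 - 3 * hev 2 + 3 * hev 1 - hev 0)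
  refine ⟨?_, fun c _ => ⟨?_, ?_, ?_⟩⟩
  · linear_combination (s₁ - s₂) * (s₃ - s₄) * (hpair₁ + hpair₂)
  · linear_combination (s₁ - s₂) * (s₃ - s₄) * (hpair₁ + hpair₂ + (c₃ - c) * hsum)
  · linear_combination (s₁ - s₄) * (s₂ - s₃) * (hpair₁ + hpair₂ + (c₃ - c) * hsum)
  · linear_combination (s₂ - s₄) * (s₁ - s₃) * (hpair₁ + hpair₂ + (c₃ - c) * hsum)
end

section
/- Let a, b be complex numbers with a ≠ 0, b ≠ 0, a² ≠ 1, b² ≠ 1, a + b ≠ 0 and ab + 1 ≠ 0. Set A = a + 1/a, B = b + 1/b and C = −(a + b)²/((a² − 1)(b² − 1)). Then C ≠ 0, C ≠ 1, and 256·(C² − C + 1)³/(C²(C − 1)²) = 256·[(A + B)² + (A² − 4)(B² − 4)]³/((A² − 4)(B² − 4)(A + B)⁴). -/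
/-- Identity (J_symm): with `A = a + 1/a`, `B = b + 1/b` and
`C = −(a + b)²/((a² − 1)(b² − 1))`, one has `C ≠ 0`, `C ≠ 1`, and the `J`-invariant
`256(C² − C + 1)³/(C²(C − 1)²)` equals
`256[(A + B)² + (A² − 4)(B² − 4)]³/((A² − 4)(B² − 4)(A + B)⁴)`. -/
theorem stmt_9 (a b : ℂ) (ha : a ≠ 0) (hb : b ≠ 0)
    (ha1 : a ^ 2 ≠ 1) (hb1 : b ^ 2 ≠ 1) (hab : a + b ≠ 0) (hab1 : a * b + 1 ≠ 0) :
    let A := a + 1 / a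
    let B := b + 1 / b
    let C := -(a + b) ^ 2 / ((a ^ 2 - 1) * (b ^ 2 - 1))
    C ≠ 0 ∧ C ≠ 1 ∧
      256 * (C ^ 2 - C + 1) ^ 3 / (C ^ 2 * (C - 1) ^ 2)
        = 256 * ((A + B) ^ 2 + (A ^ 2 - 4) * (B ^ 2 - 4)) ^ 3
          / ((A ^ 2 - 4) * (B ^ 2 - 4) * (A + B) ^ 4) := by
  intro A B C
  have ha2 : a ^ 2 - 1 ≠ 0 := sub_ne_zero.mpr ha1
  have hb2 : b ^ 2 - 1 ≠ 0 := sub_ne_zero.mpr hb1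
  have hC1 : C - 1 = -(a * b + 1) ^ 2 / ((a ^ 2 - 1) * (b ^ 2 - 1)) := by
    simp only [C]
    field_simp
    ring
  have hJ : C ^ 2 - C + 1 = ((a + b) ^ 2 * (a * b + 1) ^ 2 + ((a ^ 2 - 1) * (b ^ 2 - 1)) ^ 2)
      / ((a ^ 2 - 1) * (b ^ 2 - 1)) ^ 2 := by
    simp only [C]
    field_simp
    ring
  have hA : A ^ 2 - 4 = (a ^ 2 - 1) ^ 2 / a ^ 2 := by
    simp only [A]
    field_simp
    ring
  have hB : B ^ 2 - 4 = (b ^ 2 - 1) ^ 2 / b ^ 2 := by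
    simp only [B]
    field_simp
    ring
  have hAB : A + B = (a + b) * (a * b + 1) / (a * b) := by
    simp only [A, B]
    field_simp
    ring
  refine ⟨?_, ?_, ?_⟩
  · exact div_ne_zero (neg_ne_zero.mpr (pow_ne_zero 2 hab)) (mul_ne_zero ha2 hb2)
  · rw [← sub_ne_zero, hC1]
    exact div_ne_zero (neg_ne_zero.mpr (pow_ne_zero 2 hab1)) (mul_ne_zero ha2 hb2)
  · rw [hJ, hC1, hA, hB, hAB]
    simp only [C]
    field_simp
end

section
/- Let e1, e2, e3 be nonzero complex numbers. Define f(z) = z(z − e1)(z − e2)(z − e3)(z − e1e2e3) and g(ζ) = ζ(ζ − e1)(ζ − 1/e2)(ζ − 1/e3)(ζ − e1/(e2e3)). Then there exist complex numbers a, b, c, d, κ with ad − bc ≠ 0 and κ ≠ 0 such that for every complex ζ with cζ + d ≠ 0: (cζ + d)⁶·f((aζ + b)/(cζ + d)) = κ·g(ζ). -/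
/-- Lemma 4.1, remaining case: the reciprocal transformation
`(e₁,e₂,e₃) → (e₁, 1/e₂, 1/e₃)` of the canonical genus 2 sextic
`f(z) = z(z − e₁)(z − e₂)(z − e₃)(z − e₁e₂e₃)` is realized by a Möbius transformation:
there exist `a, b, c, d, κ` with `ad − bc ≠ 0`, `κ ≠ 0` such that
`(cζ + d)⁶·f((aζ + b)/(cζ + d)) = κ·g(ζ)` whenever `cζ + d ≠ 0`, where
`g(ζ) = ζ(ζ − e₁)(ζ − 1/e₂)(ζ − 1/e₃)(ζ − e₁/(e₂e₃))`. -/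
theorem stmt_11 (e₁ e₂ e₃ : ℂ) (h₁ : e₁ ≠ 0) (h₂ : e₂ ≠ 0) (h₃ : e₃ ≠ 0) :
    ∃ a b c d κ : ℂ, a * d - b * c ≠ 0 ∧ κ ≠ 0 ∧
      ∀ ζ : ℂ, c * ζ + d ≠ 0 →
        (c * ζ + d) ^ 6 *
            (((a * ζ + b) / (c * ζ + d))
              * ((a * ζ + b) / (c * ζ + d) - e₁)
              * ((a * ζ + b) / (c * ζ + d) - e₂)
              * ((a * ζ + b) / (c * ζ + d) - e₃)
              * ((a * ζ + b) / (c * ζ + d) - e₁ * e₂ * e₃))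
          = κ * (ζ * (ζ - e₁) * (ζ - 1 / e₂) * (ζ - 1 / e₃)
              * (ζ - e₁ / (e₂ * e₃))) := by
  refine ⟨e₂ * e₃, 0, 0, 1, (e₂ * e₃) ^ 5, ?_, ?_, fun ζ _ => ?_⟩
  · simp [h₂, h₃]
  · exact pow_ne_zero 5 (mul_ne_zero h₂ h₃)
  · simp only [zero_mul, zero_add, add_zero, div_one, one_pow, one_mul]
    field_simp
end

section
/- Let J be the 4×4 rational matrix with rows (0,0,1,0), (0,0,0,1), (−1,0,0,0), (0,−1,0,0), let J₁₂ be the 4×4 rational matrix with rows (0,0,1,0), (0,0,0,2), (−1,0,0,0), (0,−2,0,0), and let D₁ = diag(2,1,1,1). Suppose A and B are invertible 4×4 rational matrices satisfying Aᵀ·J₁₂·A = J₁₂ and Bᵀ·J₁₂·B = J₁₂. Then the matrix T = D₁⁻¹·B⁻¹·A·D₁ satisfies Tᵀ·J·T = J. -/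
open Matrix

/-- The standard symplectic form `J`. -/
def Jstd : Matrix (Fin 4) (Fin 4) ℚ :=
  !![0, 0, 1, 0; 0, 0, 0, 1; -1, 0, 0, 0; 0, -1, 0, 0]

/-- The symplectic form `J₁₂` with polarization `(1,2)`. -/
def J12 : Matrix (Fin 4) (Fin 4) ℚ :=
  !![0, 0, 1, 0; 0, 0, 0, 2; -1, 0, 0, 0; 0, -2, 0, 0]

/-- The duplication matrix `D₁ = diag(2,1,1,1)`. -/
def D1 : Matrix (Fin 4) (Fin 4) ℚ := Matrix.diagonal ![2, 1, 1, 1]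

/-- The set of matrices preserving a bilinear form is closed under `(A, B) ↦ B⁻¹ * A`. -/
theorem transpose_inv_mul_mul_inv_mul {n R : Type*} [Fintype n] [DecidableEq n] [CommRing R]
    {A B J : Matrix n n R} (hB : IsUnit B.det) (hAJ : Aᵀ * J * A = J) (hBJ : Bᵀ * J * B = J) :
    (B⁻¹ * A)ᵀ * J * (B⁻¹ * A) = J := by
  have h : (B * (B⁻¹ * A))ᵀ * J * (B * (B⁻¹ * A)) = J := by
    rwa [mul_nonsing_inv_cancel_left _ _ hB]
  rw [transpose_mul] at h
  calc (B⁻¹ * A)ᵀ * J * (B⁻¹ * A) = (B⁻¹ * A)ᵀ * (Bᵀ * J * B) * (B⁻¹ * A) := by rw [hBJ]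
    _ = J := by simpa only [Matrix.mul_assoc] using h

theorem isUnit_det_D1 : IsUnit D1.det := by
  simp [D1, Fin.prod_univ_four]

/-- Up to the factor `2`, the matrix `D₁` transforms `J₁₂` into the standard form. -/
theorem Jstd_eq_smul : Jstd = (2⁻¹ : ℚ) • (D1ᵀ * J12 * D1) := by
  ext i j
  fin_cases i <;> fin_cases j <;> simp [Jstd, J12, D1]

/-- Criterion for `D₁`-equivalence: if `A` and `B` are invertible and preserve `J₁₂`, then
`T = D₁⁻¹·B⁻¹·A·D₁` is symplectic with respect to the standard form `J`. -/
theorem stmt_14 (A B : Matrix (Fin 4) (Fin 4) ℚ)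
    (hA : IsUnit A.det) (hB : IsUnit B.det)
    (hAJ : Aᵀ * J12 * A = J12) (hBJ : Bᵀ * J12 * B = J12) :
    (D1⁻¹ * B⁻¹ * A * D1)ᵀ * Jstd * (D1⁻¹ * B⁻¹ * A * D1) = Jstd := by
  have hM := transpose_inv_mul_mul_inv_mul hB hAJ hBJ
  set M := B⁻¹ * A
  have hT : D1 * (D1⁻¹ * B⁻¹ * A * D1) = M * D1 := by
    simp only [Matrix.mul_assoc, mul_nonsing_inv_cancel_left _ _ isUnit_det_D1, M]
  set T := D1⁻¹ * B⁻¹ * A * D1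
  rw [Jstd_eq_smul, Matrix.mul_smul, Matrix.smul_mul]
  congr 1
  calc Tᵀ * (D1ᵀ * J12 * D1) * T = (D1 * T)ᵀ * J12 * (D1 * T) := by
        simp only [transpose_mul, Matrix.mul_assoc]
    _ = D1ᵀ * (Mᵀ * J12 * M) * D1 := by
        rw [hT]; simp only [transpose_mul, Matrix.mul_assoc]
    _ = D1ᵀ * J12 * D1 := by rw [hM]
end
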